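/- arXiv:1907.05733 — 2 statements merged into one kernel-verified Lean document; each statement's English description precedes it below -/
import Mathlib

section
/- Let d ≥ 2, ε > 0, and let f be a map from the set ℙ(ℂ^d) of rank-one orthogonal projections in ℂ^{d×d} to itself satisfying |Tr(f(x)f(y)) − Tr(xy)| ≤ ε for all x, y ∈ ℙ(ℂ^d). Then there exists a real-linear map H : H_d → H_d on the real vector space H_d of d×d complex Hermitian matrices such that for all x ∈ ℙ(ℂ^d): ‖f(x) − H(x)‖₂ ≤ 4·(8·log₂ d)^{2 + (log₂ log₂ (2d))/2} · √(d·ε), where ‖·‖₂ is the Hilbert–Schmidt (Frobenius) norm. -/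
open Finset Matrix

/-- The real vector space of `d × d` complex Hermitian matrices. -/
noncomputable abbrev HermMat (d : ℕ) := selfAdjoint (Matrix (Fin d) (Fin d) ℂ)

/-- The Hilbert–Schmidt inner product `⟨x, y⟩ = Tr (x y)` on Hermitian matrices. -/
noncomputable def hsInner {d : ℕ} (x y : HermMat d) : ℝ :=
  (((x : Matrix (Fin d) (Fin d) ℂ) * (y : Matrix (Fin d) (Fin d) ℂ)).trace).re

/-- The Hilbert–Schmidt norm `‖x‖₂ = (Tr x²)^{1/2}` on Hermitian matrices. -/
noncomputable def hsNorm {d : ℕ} (x : HermMat d) : ℝ :=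
  Real.sqrt (hsInner x x)

/-- The set of rank-one orthogonal projections in `ℂ^{d×d}`, viewed inside the
Hermitian matrices. -/
def rankOneProjSet (d : ℕ) : Set (HermMat d) :=
  { p | ∃ v : EuclideanSpace ℂ (Fin d), ‖v‖ = 1 ∧
    (p : Matrix (Fin d) (Fin d) ℂ) = Matrix.of fun i j => v i * star (v j) }

theorem aux_factor {V W U : Type*} [AddCommGroup V] [Module ℝ V] [AddCommGroup W] [Module ℝ W]
    [AddCommGroup U] [Module ℝ U] (g : V →ₗ[ℝ] W) (k : V →ₗ[ℝ] U)
    (h : LinearMap.ker g ≤ LinearMap.ker k) : ∃ H : W →ₗ[ℝ] U, ∀ v, H (g v) = k v := by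
  obtain ⟨H, hH⟩ := LinearMap.exists_extend
    (((LinearMap.ker g).liftQ k h).comp
      (g.quotKerEquivRange.symm : LinearMap.range g →ₗ[ℝ] (V ⧸ LinearMap.ker g)))
  refine ⟨H, fun v => ?_⟩
  have := LinearMap.congr_fun hH ⟨g v, ⟨v, rfl⟩⟩
  simp only [LinearMap.comp_apply, Submodule.subtype_apply, LinearEquiv.coe_coe] at this
  rw [this]
  have h2 : g.quotKerEquivRange.symm ⟨g v, ⟨v, rfl⟩⟩ = Submodule.Quotient.mk v := by
    rw [LinearEquiv.symm_apply_eq]; rfl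
  rw [h2]; rfl

theorem aux_avg {ι E : Type*} [Fintype ι] [NormedAddCommGroup E] [InnerProductSpace ℝ E]
    [FiniteDimensional ℝ E] (x f : ι → E) (ε : ℝ)
    (h : ∀ i j, |inner ℝ (f i) (f j) - inner ℝ (x i) (x j)| ≤ ε)
    (w : ι → ℝ) (hw : ∀ i, 0 ≤ w i) (hw1 : ∑ i, w i = 1) :
    ∃ H : E →ₗ[ℝ] E, (∑ i, w i * ‖f i - H (x i)‖ ^ 2) ^ 2 ≤ Module.finrank ℝ E * ε ^ 2 := by
  classical
  let C : E →ₗ[ℝ] E := ∑ i, w i • ((innerₛₗ ℝ (x i)).smulRight (x i))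
  let D : E →ₗ[ℝ] E := ∑ i, w i • ((innerₛₗ ℝ (x i)).smulRight (f i))
  have hC : ∀ v, C v = ∑ i, (w i * inner ℝ (x i) v) • x i := by
    intro v; simp [C, LinearMap.sum_apply, smul_smul]
  have hD : ∀ v, D v = ∑ i, (w i * inner ℝ (x i) v) • f i := by
    intro v; simp [D, LinearMap.sum_apply, smul_smul]
  obtain ⟨H, hH⟩ := aux_factor C D (by
    intro v hv
    rw [LinearMap.mem_ker] at hv ⊢
    have h1 : ∑ i, w i * (inner ℝ (x i) v) ^ 2 = 0 := by
      have : inner ℝ (C v) v = 0 := by rw [hv, inner_zero_left]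
      rw [hC, sum_inner] at this
      rw [← this]
      refine Finset.sum_congr rfl fun i _ => ?_
      rw [real_inner_smul_left]; ring
    rw [Finset.sum_eq_zero_iff_of_nonneg (fun i _ => mul_nonneg (hw i) (sq_nonneg _))] at h1
    rw [hD]
    refine Finset.sum_eq_zero fun i hi => ?_
    have := h1 i hi
    have h3 : w i * inner ℝ (x i) v = 0 := by
      rcases mul_eq_zero.1 this with h | h
      · simp [h]
      · simp [pow_eq_zero_iff] at h; simp [h]
    rw [h3, zero_smul])
  refine ⟨H, ?_⟩
  set ρ : ι → E := fun i => f i - H (x i) with hρ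
  have n1 : ∀ v, ∑ i, (w i * inner ℝ (x i) v) • ρ i = 0 := by
    intro v
    have := hH v
    rw [hC, hD, map_sum] at this
    simp only [hρ, smul_sub, Finset.sum_sub_distrib, ← this, map_smul, sub_self]
  have n2 : ∀ u, ∑ i, (w i * inner ℝ (ρ i) u) • x i = 0 := by
    intro u
    refine ext_inner_right ℝ fun v => ?_
    have := congrArg (fun z => inner ℝ z u) (n1 v)
    simp only [sum_inner, inner_zero_left, real_inner_smul_left] at this ⊢
    rw [← this]
    refine Finset.sum_congr rfl fun i _ => by ring
  set M : ι → ι → ℝ := fun i j => inner ℝ (ρ i) (ρ j) with hM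
  have n3 : ∀ j v, ∑ i, w i * M i j * inner ℝ (x i) v = 0 := by
    intro j v
    have := congrArg (fun z => inner ℝ z v) (n2 (ρ j))
    simpa only [sum_inner, inner_zero_left, real_inner_smul_left] using this
  have n4 : ∀ j v, ∑ i, w i * M i j * inner ℝ (H (x i)) v = 0 := by
    intro j v
    have := congrArg (fun z => inner ℝ (H z) v) (n2 (ρ j))
    simpa only [map_sum, map_smul, map_zero, sum_inner, inner_zero_left,
      real_inner_smul_left] using this
  have n5 : ∀ j v, ∑ i, w i * M i j * inner ℝ (f i) v = ∑ i, w i * M i j * inner ℝ (ρ i) v := by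
    intro j v
    rw [← sub_eq_zero, ← n4 j v, ← Finset.sum_sub_distrib]
    refine Finset.sum_congr rfl fun i _ => ?_
    simp only [hρ, inner_sub_left]; ring
  have hMs : ∀ i j, M i j = M j i := fun i j => real_inner_comm _ _
  set S : ℝ := ∑ i, ∑ j, w i * w j * M i j ^ 2 with hS
  set Q : ℝ := ∑ i, ∑ j, w i * w j * |M i j| with hQ
  have s1 : S = ∑ i, ∑ j, w i * w j * M i j * (inner ℝ (f i) (f j) - inner ℝ (x i) (x j)) := by
    have e1 : ∑ i, ∑ j, w i * w j * M i j * inner ℝ (x i) (x j) = 0 := by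
      rw [Finset.sum_comm]
      refine Finset.sum_eq_zero fun j _ => ?_
      rw [← mul_zero (w j), ← n3 j (x j), Finset.mul_sum]
      refine Finset.sum_congr rfl fun i _ => by ring
    have e2 : ∑ i, ∑ j, w i * w j * M i j * inner ℝ (f i) (f j)
        = ∑ i, ∑ j, w i * w j * M i j * inner ℝ (ρ i) (f j) := by
      rw [Finset.sum_comm]
      conv_rhs => rw [Finset.sum_comm]
      refine Finset.sum_congr rfl fun j _ => ?_
      have := congrArg (fun z => w j * z) (n5 j (f j))
      simp only [Finset.mul_sum] at this
      calc _ = _ := Finset.sum_congr rfl fun i _ => by ring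
        _ = _ := this
        _ = _ := Finset.sum_congr rfl fun i _ => by ring
    have e3 : ∑ i, ∑ j, w i * w j * M i j * inner ℝ (ρ i) (f j) = S := by
      refine Finset.sum_congr rfl fun i _ => ?_
      have := congrArg (fun z => w i * z) (n5 i (ρ i))
      simp only [Finset.mul_sum] at this
      calc _ = _ := Finset.sum_congr rfl fun j _ => by
            rw [real_inner_comm, hMs i j]; ring
        _ = _ := this
        _ = _ := Finset.sum_congr rfl fun j _ => by
            rw [hMs i j, sq]; simp only [hM]; ring
    simp only [mul_sub, Finset.sum_sub_distrib, e1, e2, e3, sub_zero]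
  have s2 : S ≤ ε * Q := by
    rw [s1, hQ, Finset.mul_sum]
    refine Finset.sum_le_sum fun i _ => ?_
    rw [Finset.mul_sum]
    refine Finset.sum_le_sum fun j _ => ?_
    have hww := mul_nonneg (hw i) (hw j)
    calc _ ≤ |w i * w j * M i j * (inner ℝ (f i) (f j) - inner ℝ (x i) (x j))| := le_abs_self _
      _ = w i * w j * |M i j| * |inner ℝ (f i) (f j) - inner ℝ (x i) (x j)| := by
          rw [abs_mul, abs_mul, abs_of_nonneg hww]
      _ ≤ w i * w j * |M i j| * ε := by
          gcongr
          exact h i j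
      _ = _ := by ring
  have s3 : Q ^ 2 ≤ S := by
    have := Finset.sum_mul_sq_le_sq_mul_sq (Finset.univ : Finset (ι × ι))
      (fun p => √(w p.1 * w p.2)) (fun p => √(w p.1 * w p.2) * |M p.1 p.2|)
    have q : ∀ p : ι × ι, √(w p.1 * w p.2) * √(w p.1 * w p.2) = w p.1 * w p.2 :=
      fun p => Real.mul_self_sqrt (mul_nonneg (hw _) (hw _))
    simp only [← mul_assoc, mul_pow, sq_abs, sq (√ _), q] at this
    simp only [Fintype.sum_prod_type] at this
    rw [← Finset.sum_mul_sum, hw1, one_mul, one_mul] at this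
    exact this
  have hQ0 : 0 ≤ Q := Finset.sum_nonneg fun i _ => Finset.sum_nonneg fun j _ =>
    mul_nonneg (mul_nonneg (hw i) (hw j)) (abs_nonneg _)
  have s4 : S ≤ ε ^ 2 := by nlinarith [sq_nonneg (Q - ε)]
  let b := stdOrthonormalBasis ℝ E
  have pars : ∀ y z : E, inner ℝ y z = ∑ k, inner ℝ y (b k) * inner ℝ z (b k) := by
    intro y z
    rw [← b.sum_inner_mul_inner y z]
    refine Finset.sum_congr rfl fun k _ => by rw [real_inner_comm z]
  set N : Fin (Module.finrank ℝ E) → Fin (Module.finrank ℝ E) → ℝ :=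
    fun k l => ∑ i, w i * (inner ℝ (ρ i) (b k) * inner ℝ (ρ i) (b l)) with hN
  have t1 : ∑ i, w i * ‖ρ i‖ ^ 2 = ∑ k, N k k := by
    simp only [hN]
    rw [Finset.sum_comm]
    refine Finset.sum_congr rfl fun i _ => ?_
    rw [← Finset.mul_sum, ← pars, real_inner_self_eq_norm_sq]
  have t2 : ∑ k, ∑ l, N k l ^ 2 = S := by
    have : ∀ k l, N k l ^ 2 = ∑ i, ∑ j, w i * w j *
       ((inner ℝ (ρ i) (b k) * inner ℝ (ρ j) (b k)) *
       (inner ℝ (ρ i) (b l) * inner ℝ (ρ j) (b l))) := by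
      intro k l
      rw [sq, hN, Finset.sum_mul_sum]
      refine Finset.sum_congr rfl fun i _ => Finset.sum_congr rfl fun j _ => by ring
    simp only [this]
    have sw : ∀ F : Fin (Module.finrank ℝ E) → Fin (Module.finrank ℝ E) → ι → ι → ℝ,
      ∑ k, ∑ l, ∑ i, ∑ j, F k l i j = ∑ i, ∑ j, ∑ k, ∑ l, F k l i j := by
      intro F
      calc _ = ∑ k, ∑ i, ∑ l, ∑ j, F k l i j :=
            Finset.sum_congr rfl fun k _ => Finset.sum_comm
        _ = ∑ i, ∑ k, ∑ l, ∑ j, F k l i j := Finset.sum_comm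
        _ = ∑ i, ∑ k, ∑ j, ∑ l, F k l i j :=
            Finset.sum_congr rfl fun i _ => Finset.sum_congr rfl fun k _ => Finset.sum_comm
        _ = _ := Finset.sum_congr rfl fun i _ => Finset.sum_comm
    rw [sw]
    refine Finset.sum_congr rfl fun i _ => Finset.sum_congr rfl fun j _ => ?_
    simp only [← Finset.mul_sum]
    rw [← Finset.sum_mul, ← pars, sq]
  rw [t1]
  calc (∑ k, N k k) ^ 2 ≤ Module.finrank ℝ E * ∑ k, N k k ^ 2 := by
        have := sq_sum_le_card_mul_sum_sq (s := Finset.univ) (f := fun k => N k k)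
        simpa using this
    _ ≤ Module.finrank ℝ E * ∑ k, ∑ l, N k l ^ 2 := by
        gcongr with k _
        exact Finset.single_le_sum (f := fun l => N k l ^ 2) (fun l _ => sq_nonneg _)
          (Finset.mem_univ k)
    _ ≤ _ := by
        rw [t2]; gcongr

theorem aux_finite {ι E : Type*} [Fintype ι] [NormedAddCommGroup E] [InnerProductSpace ℝ E]
    [FiniteDimensional ℝ E] (x f : ι → E) (ε : ℝ)
    (h : ∀ i j, |inner ℝ (f i) (f j) - inner ℝ (x i) (x j)| ≤ ε)
    (c : ℝ) (hc0 : 0 < c) (hc : Module.finrank ℝ E * ε ^ 2 < c ^ 2) :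
    ∃ H : E →ₗ[ℝ] E, ∀ i, ‖f i - H (x i)‖ ^ 2 ≤ c := by
  classical
  let A : Set (ι → ℝ) := ⋃ H : E →ₗ[ℝ] E, Set.univ.pi fun i => Set.Ioi (‖f i - H (x i)‖ ^ 2)
  have hAo : IsOpen A := isOpen_iUnion fun H =>
    isOpen_set_pi Set.finite_univ fun i _ => isOpen_Ioi
  have memA : ∀ v, v ∈ A ↔ ∃ H : E →ₗ[ℝ] E, ∀ i, ‖f i - H (x i)‖ ^ 2 < v i := by
    intro v; simp [A]
  have hAc : Convex ℝ A := by
    intro u hu v hv a b ha hb hab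
    rw [memA] at hu hv ⊢
    obtain ⟨H, hH⟩ := hu
    obtain ⟨K, hK⟩ := hv
    refine ⟨a • H + b • K, fun i => ?_⟩
    have e : f i - (a • H + b • K) (x i) = a • (f i - H (x i)) + b • (f i - K (x i)) := by
      have : f i = a • f i + b • f i := by rw [← add_smul, hab, one_smul]
      simp only [LinearMap.add_apply, LinearMap.smul_apply, smul_sub]
      nth_rewrite 1 [this]
      abel
    rw [e]
    have n1 : ‖a • (f i - H (x i)) + b • (f i - K (x i))‖ ≤
        a * ‖f i - H (x i)‖ + b * ‖f i - K (x i)‖ := by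
      refine (norm_add_le _ _).trans ?_
      rw [norm_smul, norm_smul, Real.norm_of_nonneg ha, Real.norm_of_nonneg hb]
    have h1 := hH i
    have h2 := hK i
    set p := ‖f i - H (x i)‖
    set q := ‖f i - K (x i)‖
    have n2 : (a * p + b * q) ^ 2 ≤ a * p ^ 2 + b * q ^ 2 := by
      obtain rfl : b = 1 - a := by linarith
      nlinarith [mul_nonneg (mul_nonneg ha hb) (sq_nonneg (p - q))]
    have n3 : a * p ^ 2 + b * q ^ 2 < a * u i + b * v i := by
      rcases ha.eq_or_lt with rfl | ha'
      · have : b = 1 := by linarith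
        subst this; linarith
      · nlinarith
    simp only [Pi.add_apply, Pi.smul_apply, smul_eq_mul]
    calc _ ≤ (a * p + b * q) ^ 2 := by gcongr
      _ < _ := by linarith
  by_cases hmem : (fun _ => c) ∈ A
  · obtain ⟨H, hH⟩ := (memA _).1 hmem
    exact ⟨H, fun i => (hH i).le⟩
  exfalso
  obtain ⟨ℓ, hℓ⟩ := geometric_hahn_banach_open_point hAc hAo hmem
  set y : ι → ℝ := fun i => - ℓ (Pi.single i 1) with hy
  have lv : ∀ v : ι → ℝ, ℓ v = - ∑ i, y i * v i := by
    intro v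
    conv_lhs => rw [← Finset.univ_sum_single v]
    rw [map_sum, ← Finset.sum_neg_distrib]
    refine Finset.sum_congr rfl fun i _ => ?_
    have : (Pi.single i (v i) : ι → ℝ) = v i • Pi.single i 1 := by
      rw [← Pi.single_smul]; simp
    rw [this, map_smul, hy, smul_eq_mul]; ring
  have hB : ∀ v ∈ A, (∑ i, y i) * c < ∑ i, y i * v i := by
    intro v hv
    have := hℓ v hv
    rw [lv, lv, ← Finset.sum_mul] at this
    linarith
  let v0 : ι → ℝ := fun i => ‖f i - (0 : E →ₗ[ℝ] E) (x i)‖ ^ 2 + 1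
  have hv0 : ∀ (i : ι) (t : ℝ), 0 ≤ t → v0 + t • Pi.single i 1 ∈ A := by
    intro i t ht
    rw [memA]
    refine ⟨0, fun j => ?_⟩
    have : 0 ≤ t * (Pi.single i 1 : ι → ℝ) j := by
      by_cases hij : j = i
      · subst hij; simpa using ht
      · simp [hij]
    simp only [v0, Pi.add_apply, Pi.smul_apply, smul_eq_mul]
    linarith
  have hv00 : v0 ∈ A := (memA _).2 ⟨0, fun j => by simp [v0]⟩
  have hy0 : ∀ i, 0 ≤ y i := by
    intro i
    by_contra hneg
    push Not at hneg
    have key : ∀ t : ℝ, 0 ≤ t → (∑ i, y i) * c < ∑ i, y i * v0 i + t * y i := by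
      intro t ht
      have := hB _ (hv0 i t ht)
      simp only [Pi.add_apply, Pi.smul_apply, smul_eq_mul, mul_add, Finset.sum_add_distrib] at this
      have e : ∑ j, y j * (t * (Pi.single i 1 : ι → ℝ) j) = t * y i := by
        rw [Finset.sum_eq_single i]
        · simp; ring
        · intro j _ hj; simp [hj]
        · simp
      rwa [e] at this
    have k0 := key 0 le_rfl
    have := key ((∑ i, y i * v0 i - (∑ i, y i) * c) / (- y i)) (by
      apply div_nonneg <;> linarith)
    have e : (∑ i, y i * v0 i - (∑ i, y i) * c) / (- y i) * y i
        = - (∑ i, y i * v0 i - (∑ i, y i) * c) := by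
      have := hneg.ne
      rw [div_neg, neg_mul, div_mul_cancel₀ _ this]
    rw [e] at this
    linarith
  have hY : 0 < ∑ i, y i := by
    rcases (Finset.sum_nonneg fun i _ => hy0 i : 0 ≤ ∑ i, y i).eq_or_lt with h0 | h0
    · exfalso
      have z := (Finset.sum_eq_zero_iff_of_nonneg (fun i _ => hy0 i)).1 h0.symm
      have := hB _ hv00
      rw [← h0, Finset.sum_eq_zero (fun i hi => by rw [z i hi, zero_mul])] at this
      simp at this
    · exact h0
  set Y := ∑ i, y i with hYdef
  obtain ⟨H, hH⟩ := aux_avg x f ε h (fun i => y i / Y) (fun i => div_nonneg (hy0 i) hY.le)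
    (by rw [← Finset.sum_div, div_self hY.ne'])
  set T := ∑ i, y i / Y * ‖f i - H (x i)‖ ^ 2 with hT
  have hTc : T < c := by
    by_contra hcon
    push Not at hcon
    nlinarith
  have := hB (fun i => ‖f i - H (x i)‖ ^ 2 + (c - T) / 2) ((memA _).2 ⟨H, fun i => by linarith⟩)
  simp only [mul_add, Finset.sum_add_distrib, ← Finset.sum_mul] at this
  have e : ∑ i, y i * ‖f i - H (x i)‖ ^ 2 = Y * T := by
    rw [hT, Finset.mul_sum]
    refine Finset.sum_congr rfl fun i _ => by field_simp
  rw [e, ← hYdef] at this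
  nlinarith

theorem aux_main {ι E : Type*} [NormedAddCommGroup E] [InnerProductSpace ℝ E]
    [FiniteDimensional ℝ E] (x f : ι → E) (ε : ℝ)
    (h : ∀ i j, |inner ℝ (f i) (f j) - inner ℝ (x i) (x j)| ≤ ε)
    (c : ℝ) (hc0 : 0 < c) (hc : Module.finrank ℝ E * ε ^ 2 < c ^ 2) :
    ∃ H : E →ₗ[ℝ] E, ∀ i, ‖f i - H (x i)‖ ^ 2 ≤ c := by
  classical
  have : ProperSpace E := FiniteDimensional.proper ℝ E
  let K : Set (ι → E) := Set.univ.pi fun i => Metric.closedBall (f i) √c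
  have hK : IsCompact K := isCompact_univ_pi fun i => isCompact_closedBall _ _
  let R := LinearMap.ker (Finsupp.linearCombination ℝ x)
  let Z : R → Set (ι → E) := fun a => {y | Finsupp.linearCombination ℝ y (a : ι →₀ ℝ) = 0}
  have hZ : ∀ a, IsClosed (Z a) := by
    intro a
    refine isClosed_eq ?_ continuous_const
    simp only [Finsupp.linearCombination_apply, Finsupp.sum]
    fun_prop
  obtain ⟨y, hyK, hyZ⟩ := hK.inter_iInter_nonempty Z hZ (by
    intro u
    let T : Finset ι := u.biUnion fun a => (a : ι →₀ ℝ).support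
    obtain ⟨H, hH⟩ := aux_finite (fun i : T => x i) (fun i : T => f i) ε
      (fun i j => h i j) c hc0 hc
    refine ⟨fun i => if i ∈ T then H (x i) else f i, ?_, ?_⟩
    · intro i _
      simp only [Metric.mem_closedBall]
      split_ifs with hi
      · rw [dist_comm, dist_eq_norm]
        exact Real.le_sqrt_of_sq_le (hH ⟨i, hi⟩)
      · simp
    · simp only [Set.mem_iInter]
      intro a ha
      have h0 : Finsupp.linearCombination ℝ x (a : ι →₀ ℝ) = 0 := a.2
      have h1 := congrArg H h0
      rw [map_zero, Finsupp.linearCombination_apply, Finsupp.sum, map_sum] at h1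
      simp only [Z, Set.mem_ofPred_eq, Finsupp.linearCombination_apply, Finsupp.sum]
      rw [← h1]
      refine Finset.sum_congr rfl fun i hi => ?_
      rw [if_pos (Finset.mem_biUnion.2 ⟨a, ha, hi⟩), map_smul])
  obtain ⟨H, hH⟩ := aux_factor (Finsupp.linearCombination ℝ x) (Finsupp.linearCombination ℝ y) (by
    intro a ha
    exact Set.mem_iInter.1 hyZ ⟨a, ha⟩)
  refine ⟨H, fun i => ?_⟩
  have h1 := hH (Finsupp.single i 1)
  simp only [Finsupp.linearCombination_single, one_smul] at h1
  have h2 := hyK i (Set.mem_univ i)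
  rw [Metric.mem_closedBall, dist_comm, dist_eq_norm] at h2
  rw [h1, ← Real.sq_sqrt hc0.le]
  gcongr

theorem aux_rank (d : ℕ) : FiniteDimensional ℝ (HermMat d) ∧
    Module.finrank ℝ (HermMat d) ≤ 2 * d ^ 2 := by
  have h1 : FiniteDimensional ℝ (Matrix (Fin d) (Fin d) ℂ) := inferInstance
  have h2 : Module.finrank ℝ (Matrix (Fin d) (Fin d) ℂ) = 2 * d ^ 2 := by
    rw [Module.finrank_matrix, Complex.finrank_real_complex]; simp; ring
  refine ⟨inferInstanceAs (FiniteDimensional ℝ (selfAdjoint.submodule ℝ (Matrix (Fin d) (Fin d) ℂ))), ?_⟩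
  rw [← h2]
  exact Submodule.finrank_le (selfAdjoint.submodule ℝ (Matrix (Fin d) (Fin d) ℂ))

theorem aux_self {d : ℕ} (x : HermMat d) :
    hsInner x x = ∑ i, ∑ j, ‖(x : Matrix (Fin d) (Fin d) ℂ) i j‖ ^ 2 := by
  have hx : star (x : Matrix (Fin d) (Fin d) ℂ) = x := x.2
  have e : ∀ i j, (x : Matrix (Fin d) (Fin d) ℂ) j i =
      star ((x : Matrix (Fin d) (Fin d) ℂ) i j) := by
    intro i j
    conv_lhs => rw [← hx]
    rfl
  unfold hsInner
  simp only [Matrix.trace, Matrix.diag, Matrix.mul_apply, Complex.re_sum]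
  refine Finset.sum_congr rfl fun i _ => Finset.sum_congr rfl fun j _ => ?_
  rw [e i j, ← Complex.normSq_eq_norm_sq, Complex.star_def, Complex.mul_conj]
  simp

@[reducible] noncomputable def auxCore (d : ℕ) : InnerProductSpace.Core ℝ (HermMat d) where
  inner x y := hsInner x y
  conj_inner_symm x y := by
    simp only [conj_trivial]; unfold hsInner; rw [Matrix.trace_mul_comm]
  re_inner_nonneg x := by
    simp only [RCLike.re_to_real]; rw [aux_self]; positivity
  add_left x y z := by
    unfold hsInner; simp [add_mul]
  smul_left x y r := by
    unfold hsInner; simp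
  definite x hx := by
    have hx : hsInner x x = 0 := hx
    rw [aux_self] at hx
    ext i j
    rw [Finset.sum_eq_zero_iff_of_nonneg (fun _ _ => by positivity)] at hx
    have := hx i (Finset.mem_univ _)
    rw [Finset.sum_eq_zero_iff_of_nonneg (fun _ _ => by positivity)] at this
    simpa using this j (Finset.mem_univ _)

theorem stmt9 (d : ℕ) (hd : 2 ≤ d) (ε : ℝ) (hε : 0 < ε)
    (f : HermMat d → HermMat d)
    (hmap : ∀ p ∈ rankOneProjSet d, f p ∈ rankOneProjSet d)
    (hsym : ∀ p ∈ rankOneProjSet d, ∀ q ∈ rankOneProjSet d,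
      |hsInner (f p) (f q) - hsInner p q| ≤ ε) :
    ∃ H : HermMat d →ₗ[ℝ] HermMat d, ∀ p ∈ rankOneProjSet d,
      hsNorm (f p - H p) ≤
        4 * (8 * Real.logb 2 d) ^ ((2 : ℝ) + Real.logb 2 (Real.logb 2 (2 * d)) / 2) *
          Real.sqrt (d * ε) := by
  have hd' : (2 : ℝ) ≤ d := by exact_mod_cast hd
  obtain ⟨hfd, hrk⟩ := aux_rank d
  have hrk' : (Module.finrank ℝ (HermMat d) : ℝ) ≤ 2 * (d : ℝ) ^ 2 := by exact_mod_cast hrk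
  have hmain : ∃ H : HermMat d →ₗ[ℝ] HermMat d, ∀ p : rankOneProjSet d,
      hsInner (f p - H p) (f p - H p) ≤ 2 * (d * ε) := by
    letI i1 : NormedAddCommGroup (HermMat d) := (auxCore d).toNormedAddCommGroup
    letI i2 : InnerProductSpace ℝ (HermMat d) := InnerProductSpace.ofCore (auxCore d).toCore
    obtain ⟨H, hH⟩ := aux_main (E := HermMat d) (fun p : rankOneProjSet d => (p : HermMat d))
      (fun p => f p) ε (fun p q => hsym p p.2 q q.2) (2 * (d * ε)) (by positivity) (by
        have : 0 < (d : ℝ) ^ 2 * ε ^ 2 := by positivity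
        calc _ ≤ 2 * (d : ℝ) ^ 2 * ε ^ 2 := by gcongr
          _ < _ := by nlinarith)
    refine ⟨H, fun p => ?_⟩
    have := hH p
    rw [← real_inner_self_eq_norm_sq] at this
    exact this
  obtain ⟨H, hH⟩ := hmain
  refine ⟨H, fun p hp => ?_⟩
  have hl : 1 ≤ Real.logb 2 d := by
    rw [Real.le_logb_iff_rpow_le (by norm_num) (by linarith)]; simpa using hd'
  have hl2 : 1 ≤ Real.logb 2 (2 * d) := by
    rw [Real.le_logb_iff_rpow_le (by norm_num) (by linarith)]; simp; linarith
  have hl3 : 0 ≤ Real.logb 2 (Real.logb 2 (2 * d)) := Real.logb_nonneg (by norm_num) hl2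
  have hp1 : 1 ≤ (8 * Real.logb 2 d) ^ ((2 : ℝ) + Real.logb 2 (Real.logb 2 (2 * d)) / 2) :=
    Real.one_le_rpow (by linarith) (by linarith)
  unfold hsNorm
  calc √(hsInner (f p - H p) (f p - H p)) ≤ √(4 ^ 2 * (d * ε)) := by
        apply Real.sqrt_le_sqrt
        have := hH ⟨p, hp⟩
        have : 0 < d * ε := by positivity
        linarith
    _ = 4 * √(d * ε) := by rw [Real.sqrt_mul (by norm_num), Real.sqrt_sq (by norm_num)]
    _ ≤ _ := by
        gcongr
        linarith
end

section
/- Let d ≥ 1, ε > 0, and let f be a continuous function from the closed unit ball B of S₂^d (Hermitian d×d matrices with the Hilbert–Schmidt norm) to S₂^d satisfying |⟨f(x),f(y)⟩ − ⟨x,y⟩| ≤ ε for all x, y ∈ B. Then there exists a real-linear map H : S₂^d → S₂^d such that for all x ∈ B: ‖f(x) − H(x)‖₂ ≤ 79·√ε·(1 + log₂ d). -/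
open Finset Matrix

namespace QLAux
set_option linter.unusedSectionVars false
open MeasureTheory

variable {ι : Type} [Fintype ι] [DecidableEq ι]
variable {V : Type} [NormedAddCommGroup V] [InnerProductSpace ℝ V]

noncomputable def avg (g : EuclideanSpace ℝ ι → ℝ) : ℝ :=
  ∫ c in Metric.closedBall (0 : EuclideanSpace ℝ ι) 1, g c

lemma avg_int {g : EuclideanSpace ℝ ι → ℝ} (hg : Continuous g) :
    IntegrableOn g (Metric.closedBall (0 : EuclideanSpace ℝ ι) 1) :=
  hg.continuousOn.integrableOn_compact (isCompact_closedBall _ _)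

lemma avg_inv (R : EuclideanSpace ℝ ι ≃ₗᵢ[ℝ] EuclideanSpace ℝ ι) (g : EuclideanSpace ℝ ι → ℝ) :
    avg (fun c => g (R c)) = avg g := by
  have h := R.measurePreserving.setIntegral_preimage_emb
    R.toHomeomorph.measurableEmbedding g (Metric.closedBall 0 1)
  have h2 : R ⁻¹' (Metric.closedBall (0 : EuclideanSpace ℝ ι) 1) = Metric.closedBall 0 1 := by
    ext x; simp
  rw [h2] at h
  exact h

lemma avg_add {g h : EuclideanSpace ℝ ι → ℝ} (hg : Continuous g) (hh : Continuous h) :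
    avg (fun c => g c + h c) = avg g + avg h :=
  integral_add (avg_int hg) (avg_int hh)

lemma avg_mul (r : ℝ) (g : EuclideanSpace ℝ ι → ℝ) :
    avg (fun c => r * g c) = r * avg g :=
  integral_const_mul r _

lemma avg_mono {g h : EuclideanSpace ℝ ι → ℝ} (hg : Continuous g) (hh : Continuous h)
    (hle : ∀ c, g c ≤ h c) : avg g ≤ avg h :=
  integral_mono (avg_int hg) (avg_int hh) hle

lemma avg_sum {κ : Type} (s : Finset κ) (g : κ → EuclideanSpace ℝ ι → ℝ)
    (hg : ∀ k ∈ s, Continuous (g k)) :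
    avg (fun c => ∑ k ∈ s, g k c) = ∑ k ∈ s, avg (g k) :=
  integral_finsetSum s fun k hk => avg_int (hg k hk)

lemma avg_odd (R : EuclideanSpace ℝ ι ≃ₗᵢ[ℝ] EuclideanSpace ℝ ι) (g : EuclideanSpace ℝ ι → ℝ)
    (h : ∀ c, g (R c) = - g c) : avg g = 0 := by
  have h1 := avg_inv R g
  have h2 : avg (fun c => g (R c)) = - avg g := by
    simp only [h]
    exact integral_neg _
  linarith

noncomputable def flipS (S : Finset ι) : EuclideanSpace ℝ ι ≃ₗᵢ[ℝ] EuclideanSpace ℝ ι :=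
  LinearIsometryEquiv.piLpCongrRight 2
    (fun i => if i ∈ S then LinearIsometryEquiv.neg ℝ else LinearIsometryEquiv.refl ℝ ℝ)

lemma flipS_mem (S : Finset ι) (c : EuclideanSpace ℝ ι) (i : ι) (h : i ∈ S) :
    flipS S c i = - c i := by
  simp [flipS, h]

lemma flipS_not_mem (S : Finset ι) (c : EuclideanSpace ℝ ι) (i : ι) (h : i ∉ S) :
    flipS S c i = c i := by
  simp [flipS, h]

lemma continuous_coord (i : ι) : Continuous (fun c : EuclideanSpace ℝ ι => c i) := by fun_prop

noncomputable def mom (ι : Type) [Fintype ι] [DecidableEq ι] : ℝ :=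
  avg (fun c : EuclideanSpace ℝ ι => ‖c‖ ^ 2) / Fintype.card ι

lemma avg_same (i j : ι) : avg (fun c : EuclideanSpace ℝ ι => c i ^ 2) = avg (fun c => c j ^ 2) := by
  rw [← avg_inv (LinearIsometryEquiv.piLpCongrLeft 2 ℝ ℝ (Equiv.swap i j)) (fun c => c j ^ 2)]
  simp [LinearIsometryEquiv.piLpCongrLeft_apply, Equiv.piCongrLeft']

lemma avg_coord (i : ι) : avg (fun c : EuclideanSpace ℝ ι => c i ^ 2) = mom ι := by
  have : Nonempty ι := ⟨i⟩
  have h : avg (fun c : EuclideanSpace ℝ ι => ‖c‖ ^ 2)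
      = Fintype.card ι * avg (fun c : EuclideanSpace ℝ ι => c i ^ 2) := by
    simp only [EuclideanSpace.norm_sq_eq, Real.norm_eq_abs, sq_abs]
    rw [avg_sum _ _ (fun k _ => by fun_prop), Finset.sum_congr rfl (fun k _ => avg_same k i)]
    simp
  rw [mom, h]
  field_simp

lemma avg_cross {i j : ι} (h : i ≠ j) : avg (fun c : EuclideanSpace ℝ ι => c i * c j) = 0 := by
  apply avg_odd (flipS {i})
  intro c
  rw [flipS_mem _ _ _ (by simp), flipS_not_mem _ _ j (by simp [h.symm])]
  ring

lemma mom_pos [Nonempty ι] : 0 < mom ι := by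
  unfold mom
  refine div_pos ?_ (by exact_mod_cast Fintype.card_pos)
  unfold avg
  rw [setIntegral_pos_iff_support_of_nonneg_ae]
  · have : (Metric.ball (0 : EuclideanSpace ℝ ι) 1 \ {0}) ⊆
        Function.support (fun c : EuclideanSpace ℝ ι => ‖c‖ ^ 2) ∩ Metric.closedBall 0 1 := by
      rintro x ⟨hx, hx0⟩
      refine ⟨?_, Metric.ball_subset_closedBall hx⟩
      simpa using hx0
    refine lt_of_lt_of_le ?_ (measure_mono this)
    have h1 : IsOpen (Metric.ball (0 : EuclideanSpace ℝ ι) 1 \ {0}) :=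
      Metric.isOpen_ball.sdiff isClosed_singleton
    refine h1.measure_pos volume ?_
    obtain ⟨i⟩ := ‹Nonempty ι›
    refine ⟨EuclideanSpace.single i (1/2 : ℝ), ?_, ?_⟩
    · simp; norm_num
    · simp
  · exact Filter.Eventually.of_forall fun c => by positivity
  · exact avg_int (by fun_prop)

/-- second moment of a linear combination over S -/
lemma avg_lin (S : Finset ι) (a : ι → V) :
    avg (fun c : EuclideanSpace ℝ ι => ‖∑ j ∈ S, c j • a j‖ ^ 2)
      = mom ι * ∑ j ∈ S, ‖a j‖ ^ 2 := by
  have h : ∀ c : EuclideanSpace ℝ ι, ‖∑ j ∈ S, c j • a j‖ ^ 2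
      = ∑ i ∈ S, ∑ j ∈ S, (inner ℝ (a i) (a j)) * (c i * c j) := by
    intro c
    rw [← real_inner_self_eq_norm_sq, sum_inner]
    refine Finset.sum_congr rfl fun i _ => ?_
    rw [inner_sum]
    refine Finset.sum_congr rfl fun j _ => ?_
    rw [inner_smul_left, inner_smul_right]; simp; ring
  simp only [h]
  rw [avg_sum _ _ (fun k _ => by fun_prop), Finset.mul_sum]
  refine Finset.sum_congr rfl fun i hi => ?_
  rw [avg_sum _ _ (fun k _ => by fun_prop), Finset.sum_eq_single i]
  · rw [avg_mul]
    have := avg_coord i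
    simp only [pow_two] at this
    rw [this, real_inner_self_eq_norm_sq]; ring
  · intro j _ hj
    rw [avg_mul, avg_cross hj.symm, mul_zero]
  · intro h; exact absurd hi h

structure QL (F : V → V) (ε : ℝ) : Prop where
  cont : Continuous F
  hom : ∀ (c : ℝ) x, F (c • x) = c • F x
  app : ∀ x y, |inner ℝ (F x) (F y) - inner ℝ x y| ≤ ε * (‖x‖ * ‖y‖)

lemma QL.three {F : V → V} {ε : ℝ} (h : QL F ε) (x y : V) :
    ‖F x + F y - F (x + y)‖ ^ 2 ≤ 3 * ε * (‖x‖ ^ 2 + ‖y‖ ^ 2 + ‖x + y‖ ^ 2) := by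
  have key : ‖F x + F y - F (x + y)‖ ^ 2 ≤ ε * (‖x‖ + ‖y‖ + ‖x + y‖) ^ 2 := by
    rw [← real_inner_self_eq_norm_sq]
    simp only [inner_sub_left, inner_sub_right, inner_add_left, inner_add_right]
    have e1 := abs_le.1 (h.app x x)
    have e2 := abs_le.1 (h.app y y)
    have e3 := abs_le.1 (h.app (x+y) (x+y))
    have e4 := abs_le.1 (h.app x y)
    have e5 := abs_le.1 (h.app x (x+y))
    have e6 := abs_le.1 (h.app y (x+y))
    simp only [inner_add_left, inner_add_right] at e3 e5 e6
    rw [real_inner_comm x y] at *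
    rw [real_inner_comm (F x) (F y), real_inner_comm (F x) (F (x+y)),
      real_inner_comm (F y) (F (x+y))] at *
    nlinarith
  have hε : 0 ≤ ε ∨ (‖x‖ + ‖y‖ + ‖x+y‖) = 0 := by
    by_contra hc
    push Not at hc
    have := sq_nonneg (‖F x + F y - F (x + y)‖)
    have := pow_pos (lt_of_le_of_ne (by positivity) hc.2.symm) 2
    nlinarith
  rcases hε with hε | hε
  · have : (‖x‖ + ‖y‖ + ‖x + y‖) ^ 2 ≤ 3 * (‖x‖ ^ 2 + ‖y‖ ^ 2 + ‖x + y‖ ^ 2) := by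
      nlinarith [sq_nonneg (‖x‖ - ‖y‖), sq_nonneg (‖x‖ - ‖x+y‖), sq_nonneg (‖y‖ - ‖x+y‖)]
    nlinarith
  · have h1 := norm_nonneg x
    have h2 := norm_nonneg y
    have h3 := norm_nonneg (x+y)
    have : ‖x‖ = 0 := by linarith
    have : ‖y‖ = 0 := by linarith
    have : ‖x+y‖ = 0 := by linarith
    simp_all

noncomputable def TT (F : V → V) (a : ι → V) (S : Finset ι) (c : EuclideanSpace ℝ ι) : V :=
  ∑ j ∈ S, c j • F (a j) - F (∑ j ∈ S, c j • a j)

lemma TT_cont {F : V → V} {ε : ℝ} (h : QL F ε) (a : ι → V) (S : Finset ι) :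
    Continuous (TT F a S) := by
  have := h.cont
  unfold TT
  fun_prop

lemma TT_flip {F : V → V} {ε : ℝ} (h : QL F ε) (a : ι → V) (S : Finset ι)
    (c : EuclideanSpace ℝ ι) : TT F a S (flipS S c) = - TT F a S c := by
  unfold TT
  have e1 : ∑ j ∈ S, flipS S c j • F (a j) = (-1 : ℝ) • ∑ j ∈ S, c j • F (a j) := by
    rw [Finset.smul_sum]
    exact Finset.sum_congr rfl fun j hj => by rw [flipS_mem S c j hj]; simp
  have e2 : ∑ j ∈ S, flipS S c j • a j = (-1 : ℝ) • ∑ j ∈ S, c j • a j := by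
    rw [Finset.smul_sum]
    exact Finset.sum_congr rfl fun j hj => by rw [flipS_mem S c j hj]; simp
  rw [e1, e2, h.hom]
  simp only [neg_smul, one_smul]
  abel

lemma TT_flip' {F : V → V} (a : ι → V) (S S' : Finset ι) (hd : Disjoint S S')
    (c : EuclideanSpace ℝ ι) : TT F a S' (flipS S c) = TT F a S' c := by
  unfold TT
  have : ∀ j ∈ S', flipS S c j = c j := fun j hj =>
    flipS_not_mem S c j (Finset.disjoint_right.1 hd hj)
  have e1 : ∑ j ∈ S', flipS S c j • F (a j) = ∑ j ∈ S', c j • F (a j) :=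
    Finset.sum_congr rfl fun j hj => by rw [this j hj]
  have e2 : ∑ j ∈ S', flipS S c j • a j = ∑ j ∈ S', c j • a j :=
    Finset.sum_congr rfl fun j hj => by rw [this j hj]
  rw [e1, e2]

lemma main_ind {F : V → V} {ε : ℝ} (hε : 0 ≤ ε) (h : QL F ε) (a : ι → V) (L : ℕ) :
    ∀ S : Finset ι, S.card ≤ 2 ^ L →
    avg (fun c => ‖TT F a S c‖ ^ 2) ≤ 6 * ε * ((L : ℝ) + 1) ^ 2 * (mom ι * ∑ j ∈ S, ‖a j‖ ^ 2) := by
  have hm : ∀ S : Finset ι, 0 ≤ mom ι * ∑ j ∈ S, ‖a j‖ ^ 2 := by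
    intro S
    rw [← avg_lin]
    exact integral_nonneg fun c => by positivity
  induction L with
  | zero =>
    intro S hS
    have hz : ∀ c, TT F a S c = 0 := by
      intro c
      rcases Nat.le_one_iff_eq_zero_or_eq_one.1 (by simpa using hS) with h0 | h1
      · rw [Finset.card_eq_zero] at h0
        subst h0
        have := h.hom 0 0
        simp at this
        simp [TT, this]
      · obtain ⟨i, rfl⟩ := Finset.card_eq_one.1 h1
        simp [TT, h.hom]
    have h0 : avg (fun c => ‖TT F a S c‖ ^ 2) = 0 := by simp [hz, avg]
    rw [h0]
    have := hm S
    positivity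
  | succ L ih =>
    intro S hS
    obtain ⟨A, hAS, hA⟩ := Finset.exists_subset_card_eq (show S.card / 2 ≤ S.card by omega)
    have hdis : Disjoint A (S \ A) := Finset.disjoint_sdiff
    have hcard : (S \ A).card ≤ 2 ^ L := by
      rw [Finset.card_sdiff_of_subset hAS, pow_succ] at *; omega
    have hAc : A.card ≤ 2 ^ L := by rw [pow_succ] at hS; omega
    set B := S \ A with hB
    have hAB : A ∪ B = S := Finset.union_sdiff_of_subset hAS
    have iA := ih A hAc
    have iB := ih B hcard
    let s : Finset ι → EuclideanSpace ℝ ι → V := fun S c => ∑ j ∈ S, c j • a j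
    have hs : ∀ c, s S c = s A c + s B c := fun c => by
      simp only [s]; rw [← hAB, Finset.sum_union hdis]
    have hsplit : ∀ c, TT F a S c = (TT F a A c + TT F a B c)
        + (F (s A c) + F (s B c) - F (s A c + s B c)) := by
      intro c
      rw [← hs]
      simp only [TT, s]
      rw [← hAB, Finset.sum_union hdis]; abel
    have cA := TT_cont h a A
    have cB := TT_cont h a B
    have cS := TT_cont h a S
    have hF := h.cont
    have cs : ∀ S, Continuous (s S) := fun S => by fun_prop
    have csA := cs A
    have csB := cs B
    have csS := cs S
    -- orthogonality
    have horth : avg (fun c => ‖TT F a A c + TT F a B c‖ ^ 2)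
        = avg (fun c => ‖TT F a A c‖ ^ 2) + avg (fun c => ‖TT F a B c‖ ^ 2) := by
      have hx : avg (fun c => inner ℝ (TT F a A c) (TT F a B c)) = 0 := by
        apply avg_odd (flipS A)
        intro c
        rw [TT_flip h, TT_flip' a A B hdis, inner_neg_left]
      have : ∀ c, ‖TT F a A c + TT F a B c‖ ^ 2 = (‖TT F a A c‖ ^ 2 + ‖TT F a B c‖ ^ 2)
          + 2 * inner ℝ (TT F a A c) (TT F a B c) := fun c => by
        rw [norm_add_sq_real]; ring
      simp only [this]
      rw [avg_add (by fun_prop) (by fun_prop), avg_add (by fun_prop) (by fun_prop), avg_mul, hx]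
      ring
    have hsum : ∑ j ∈ S, ‖a j‖ ^ 2 = ∑ j ∈ A, ‖a j‖ ^ 2 + ∑ j ∈ B, ‖a j‖ ^ 2 := by
      rw [← hAB, Finset.sum_union hdis]
    have hD : avg (fun c => ‖F (s A c) + F (s B c) - F (s A c + s B c)‖ ^ 2)
        ≤ 6 * ε * (mom ι * ∑ j ∈ S, ‖a j‖ ^ 2) := by
      refine (avg_mono (by fun_prop) (h := fun c => 3 * ε * ((‖s A c‖ ^ 2 + ‖s B c‖ ^ 2) + ‖s S c‖ ^ 2))
        (by fun_prop) ?_).trans ?_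
      · intro c
        rw [hs]
        exact h.three _ _
      · rw [avg_mul, avg_add (by fun_prop) (by fun_prop), avg_add (by fun_prop) (by fun_prop)]
        simp only [s]
        rw [avg_lin, avg_lin, avg_lin, hsum]
        apply le_of_eq; ring
    set t : ℝ := (L : ℝ) + 1 with ht
    have htp : 0 < t := by positivity
    have hmain : avg (fun c => ‖TT F a S c‖ ^ 2) ≤
        (1 + 1 / t) * avg (fun c => ‖TT F a A c + TT F a B c‖ ^ 2)
        + (1 + t) * avg (fun c => ‖F (s A c) + F (s B c) - F (s A c + s B c)‖ ^ 2) := by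
      rw [← avg_mul, ← avg_mul, ← avg_add (by fun_prop) (by fun_prop)]
      refine avg_mono (by fun_prop) (by fun_prop) fun c => ?_
      rw [hsplit]
      set X := TT F a A c + TT F a B c
      set Y := (F (s A c) + F (s B c) - F (s A c + s B c))
      have h1 := norm_add_le X Y
      have h2 : ‖X + Y‖ ^ 2 ≤ (‖X‖ + ‖Y‖) ^ 2 := by gcongr
      refine h2.trans ?_
      have h3 : (1 + 1 / t) * ‖X‖ ^ 2 + (1 + t) * ‖Y‖ ^ 2 - (‖X‖ + ‖Y‖) ^ 2
        = (‖X‖ - t * ‖Y‖) ^ 2 / t := by field_simp; ring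
      have h4 : 0 ≤ (‖X‖ - t * ‖Y‖) ^ 2 / t := by positivity
      linarith
    refine hmain.trans ?_
    rw [horth]
    have hmS := hm S
    set Q := mom ι * ∑ j ∈ S, ‖a j‖ ^ 2 with hQ
    have h5 : avg (fun c => ‖TT F a A c‖ ^ 2) + avg (fun c => ‖TT F a B c‖ ^ 2)
        ≤ 6 * ε * t ^ 2 * Q := by
      rw [hQ, hsum]; linarith
    calc _ ≤ (1 + 1 / t) * (6 * ε * t ^ 2 * Q) + (1 + t) * (6 * ε * Q) := by gcongr
      _ = 6 * ε * (t + 1) ^ 2 * Q := by field_simp; ring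
      _ = _ := by rw [ht]; push_cast; ring

lemma factor {W : Type} [AddCommGroup W] [Module ℝ W] (A B : W →ₗ[ℝ] V)
    (h : ∀ w, A w = 0 → B w = 0) : ∃ H : V →ₗ[ℝ] V, ∀ w, H (A w) = B w := by
  obtain ⟨G, hG⟩ := A.rangeRestrict.exists_rightInverse_of_surjective A.range_rangeRestrict
  obtain ⟨H, hH⟩ := LinearMap.exists_extend (B ∘ₗ G)
  refine ⟨H, fun w => ?_⟩
  have h1 := LinearMap.congr_fun hH (A.rangeRestrict w)
  simp only [LinearMap.comp_apply, Submodule.subtype_apply] at h1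
  have h2 : A (G (A.rangeRestrict w)) = A w := by
    have := LinearMap.congr_fun hG (A.rangeRestrict w)
    simp only [LinearMap.comp_apply, LinearMap.id_apply] at this
    exact congrArg Subtype.val this
  have h3 : B (G (A.rangeRestrict w) - w) = 0 := h _ (by rw [map_sub, h2, sub_self])
  rw [map_sub, sub_eq_zero] at h3
  rw [← h3, ← h1]
  rfl

lemma resid_bound [Nonempty ι] {F : V → V} {ε : ℝ} (hε : 0 ≤ ε) (h : QL F ε) (a : ι → V) (L : ℕ)
    (hL : Fintype.card ι ≤ 2 ^ L) :
    ∃ H : V →ₗ[ℝ] V, ∑ i, ‖F (a i) - H (a i)‖ ^ 2 ≤ 6 * ε * ((L : ℝ) + 1) ^ 2 * ∑ i, ‖a i‖ ^ 2 := by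
  let lin : (ι → V) → EuclideanSpace ℝ ι →ₗ[ℝ] V := fun b =>
    { toFun := fun c => ∑ j, c j • b j
      map_add' := fun x y => by simp [add_smul, Finset.sum_add_distrib]
      map_smul' := fun r x => by simp [Finset.smul_sum, smul_smul] }
  have lin_ap : ∀ b c, lin b c = ∑ j, c j • b j := fun b c => rfl
  have lin_single : ∀ b i, lin b (EuclideanSpace.single i 1) = b i := fun b i => by
    rw [lin_ap, Finset.sum_eq_single i] <;> simp +contextual
  set A := lin a with hA
  set Φ := lin (fun i => F (a i)) with hΦ
  set K := LinearMap.ker A with hK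
  let P : EuclideanSpace ℝ ι →ₗ[ℝ] EuclideanSpace ℝ ι := K.starProjection.toLinearMap
  have hP : ∀ c, P c = K.starProjection c := fun c => rfl
  have hAP : ∀ c, A (P c) = 0 := fun c => by
    have : P c ∈ K := K.starProjection_apply_mem c
    exact this
  obtain ⟨H, hH⟩ := factor A (Φ ∘ₗ (LinearMap.id - P)) (by
    intro w hw
    have : P w = w := Submodule.starProjection_eq_self_iff.2 hw
    simp [this])
  refine ⟨H, ?_⟩
  let Z := Φ ∘ₗ P
  have hZ : ∀ i, F (a i) - H (a i) = Z (EuclideanSpace.single i 1) := by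
    intro i
    have h1 := hH (EuclideanSpace.single i 1)
    rw [hA, lin_single] at h1
    rw [h1]
    simp only [Z, LinearMap.comp_apply, LinearMap.sub_apply, LinearMap.id_apply, map_sub]
    rw [hΦ, lin_single]
    abel
  have hZlin : ∀ c, Z c = ∑ j, c j • Z (EuclideanSpace.single j 1) := by
    intro c
    conv_lhs => rw [show c = ∑ j, c j • EuclideanSpace.single j (1:ℝ) by
      ext i; simp [Pi.single_apply]]
    simp
  let R := K.reflection
  have hR : ∀ c, R c = (2 : ℝ) • P c - c := fun c => by
    simp only [R, Submodule.reflection_apply, hP]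
    rw [two_smul, two_smul]
  have hhom0 : ∀ x, F (-x) = - F x := fun x => by
    have := h.hom (-1) x
    simpa using this
  have hTT : ∀ c, TT F a Finset.univ c = Φ c - F (A c) := fun c => rfl
  have hZT : ∀ c, Z c = (1/2 : ℝ) • (TT F a Finset.univ c + TT F a Finset.univ (R c)) := by
    intro c
    rw [hTT, hTT, hR, map_sub, map_smul, map_sub, map_smul, hAP, smul_zero, zero_sub, hhom0]
    simp only [Z, LinearMap.comp_apply]
    module
  have cT := TT_cont h a Finset.univ
  have hle : avg (fun c => ‖Z c‖ ^ 2) ≤ avg (fun c => ‖TT F a Finset.univ c‖ ^ 2) := by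
    have cR : Continuous R := R.continuous
    have cZ : Continuous (fun c => Z c) := by
      simp only [hZT]
      fun_prop
    have e : avg (fun c => ‖TT F a Finset.univ c‖ ^ 2) =
        avg (fun c => (1/2) * ‖TT F a Finset.univ c‖ ^ 2 + (1/2) * ‖TT F a Finset.univ (R c)‖ ^ 2) := by
      rw [avg_add (by fun_prop) (by fun_prop), avg_mul, avg_mul,
        avg_inv R (fun c => ‖TT F a Finset.univ c‖ ^ 2)]
      ring
    rw [e]
    refine avg_mono (by fun_prop) (by fun_prop) fun c => ?_
    rw [hZT, norm_smul, mul_pow]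
    set X := TT F a Finset.univ c
    set Y := TT F a Finset.univ (R c)
    have h1 := norm_add_le X Y
    have h2 : ‖X + Y‖ ^ 2 ≤ (‖X‖ + ‖Y‖) ^ 2 := by gcongr
    norm_num
    nlinarith [sq_nonneg (‖X‖ - ‖Y‖)]
  have hfin := hle.trans (main_ind hε h a L Finset.univ hL)
  rw [show (fun c => ‖Z c‖ ^ 2) = (fun c : EuclideanSpace ℝ ι =>
    ‖∑ j, c j • Z (EuclideanSpace.single j 1)‖ ^ 2) from funext fun c => by rw [← hZlin], avg_lin] at hfin
  simp only [← hZ] at hfin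
  have hm := mom_pos (ι := ι)
  refine le_of_mul_le_mul_left (hfin.trans (le_of_eq ?_)) hm
  ring

lemma minimax (q : ι → (V →ₗ[ℝ] V) → ℝ) (hq : ∀ i, ConvexOn ℝ Set.univ (q i)) (A B : ℝ)
    (hAB : A < B)
    (hp : ∀ p : ι → ℝ, (∀ i, 0 ≤ p i) → ∃ H, ∑ i, p i * q i H ≤ A * ∑ i, p i) :
    ∃ H, ∀ i, q i H < B := by
  by_contra hcon
  push Not at hcon
  let O : Set (ι → ℝ) := {t | ∀ i, t i < B}
  let S : Set (ι → ℝ) := {t | ∃ H, ∀ i, q i H ≤ t i}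
  have hO : O = Set.univ.pi (fun _ => Set.Iio B) := by ext; simp [O]
  have hO1 : Convex ℝ O := by rw [hO]; exact convex_pi fun i _ => convex_Iio B
  have hO2 : IsOpen O := by rw [hO]; exact isOpen_set_pi Set.finite_univ fun i _ => isOpen_Iio
  have hS : Convex ℝ S := by
    rintro t ⟨H, hH⟩ t' ⟨H', hH'⟩ α β hα hβ hαβ
    refine ⟨α • H + β • H', fun i => ?_⟩
    refine ((hq i).2 (Set.mem_univ H) (Set.mem_univ H') hα hβ hαβ).trans ?_
    simp only [Pi.add_apply, Pi.smul_apply, smul_eq_mul]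
    have := hH i
    have := hH' i
    gcongr
  have hdisj : Disjoint O S := by
    rw [Set.disjoint_left]
    rintro t ht ⟨H, hH⟩
    obtain ⟨i, hi⟩ := hcon H
    exact absurd (ht i) (not_lt.2 (hi.trans (hH i)))
  obtain ⟨φ, u, h1, h2⟩ := geometric_hahn_banach_open hO1 hO2 hS hdisj
  let p : ι → ℝ := fun i => φ (Pi.single i 1)
  have hφ : ∀ t, φ t = ∑ i, p i * t i := by
    intro t
    conv_lhs => rw [pi_eq_sum_univ' t]
    rw [map_sum]
    refine Finset.sum_congr rfl fun i _ => ?_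
    rw [map_smul, smul_eq_mul, mul_comm]
  have hp0 : ∀ i, 0 ≤ p i := by
    intro i
    by_contra hneg
    push Not at hneg
    let s : ι → ℝ := fun i => q i 0
    have hs : ∀ r : ℝ, 0 ≤ r → u ≤ φ s + r * p i := by
      intro r hr
      have : s + r • Pi.single i 1 ∈ S := by
        refine ⟨0, fun j => ?_⟩
        simp only [s, Pi.add_apply, Pi.smul_apply, smul_eq_mul, Pi.single_apply]
        split_ifs <;> simp [hr]
      have := h2 _ this
      rwa [map_add, map_smul, smul_eq_mul] at this
    have h0 := hs 0 le_rfl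
    have h3 := hs ((φ s - u + 1) / (- p i)) (div_nonneg (by linarith) (by linarith))
    have h4 : (φ s - u + 1) / (- p i) * p i = -(φ s - u + 1) := by
      have : p i ≠ 0 := hneg.ne
      field_simp
    rw [h4] at h3
    linarith
  obtain ⟨H, hH⟩ := hp p hp0
  have h3 := h1 (fun _ => A) (fun _ => hAB)
  have h4 := h2 (fun i => q i H) ⟨H, fun i => le_rfl⟩
  rw [hφ] at h3 h4
  rw [← Finset.sum_mul] at h3
  linarith

lemma finite_approx {F : V → V} {ε : ℝ} (hε : 0 ≤ ε) (h : QL F ε) (x : ι → V)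
    (hx : ∀ i, ‖x i‖ ≤ 1) (L : ℕ) (hL : Fintype.card ι ≤ 2 ^ L) (B : ℝ)
    (hB : 6 * ε * ((L : ℝ) + 1) ^ 2 < B) :
    ∃ H : V →ₗ[ℝ] V, ∀ i, ‖F (x i) - H (x i)‖ ^ 2 < B := by
  rcases isEmpty_or_nonempty ι with he | he
  · exact ⟨0, fun i => he.elim i⟩
  refine minimax (fun i H => ‖F (x i) - H (x i)‖ ^ 2) ?_ _ B hB ?_
  · intro i
    refine ⟨convex_univ, fun H _ H' _ α β hα hβ hαβ => ?_⟩
    have e : F (x i) - (α • H + β • H') (x i) = α • (F (x i) - H (x i)) + β • (F (x i) - H' (x i)) := by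
      simp only [LinearMap.add_apply, LinearMap.smul_apply]
      rw [show β = 1 - α by linarith]
      module
    simp only [e, smul_eq_mul]
    set X := F (x i) - H (x i)
    set Y := F (x i) - H' (x i)
    have h1 : ‖α • X + β • Y‖ ≤ α * ‖X‖ + β * ‖Y‖ := by
      refine (norm_add_le _ _).trans ?_
      rw [norm_smul, norm_smul, Real.norm_of_nonneg hα, Real.norm_of_nonneg hβ]
    have h2 : ‖α • X + β • Y‖ ^ 2 ≤ (α * ‖X‖ + β * ‖Y‖) ^ 2 := by gcongr
    refine h2.trans ?_
    have hb : β = 1 - α := by linarith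
    have : α * ‖X‖ ^ 2 + β * ‖Y‖ ^ 2 - (α * ‖X‖ + β * ‖Y‖) ^ 2 = α * β * (‖X‖ - ‖Y‖) ^ 2 := by
      rw [hb]; ring
    have : 0 ≤ α * β * (‖X‖ - ‖Y‖) ^ 2 := by positivity
    linarith
  · intro p hp
    obtain ⟨H, hH⟩ := resid_bound hε h (fun i => √(p i) • x i) L hL
    refine ⟨H, ?_⟩
    have e : ∀ i, ‖F (√(p i) • x i) - H (√(p i) • x i)‖ ^ 2 = p i * ‖F (x i) - H (x i)‖ ^ 2 := by
      intro i
      rw [h.hom, map_smul, ← smul_sub, norm_smul, mul_pow, Real.norm_eq_abs, sq_abs,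
        Real.sq_sqrt (hp i)]
    simp only [e] at hH
    refine hH.trans ?_
    gcongr with i
    rw [norm_smul, mul_pow, Real.norm_eq_abs, sq_abs, Real.sq_sqrt (hp i)]
    have := hx i
    have : ‖x i‖ ^ 2 ≤ 1 := pow_le_one₀ (norm_nonneg _) this
    nlinarith [hp i]

lemma global_approx [FiniteDimensional ℝ V] {F : V → V} {ε : ℝ} (hε : 0 < ε) (h : QL F ε)
    (L : ℕ) (hL : Module.finrank ℝ V * Module.finrank ℝ V + 1 + Module.finrank ℝ V ≤ 2 ^ L) :
    ∃ H : V →ₗ[ℝ] V, ∀ x, ‖x‖ ≤ 1 → ‖F x - H x‖ ≤ 3 * √ε * ((L : ℝ) + 1) := by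
  set M := 3 * √ε * ((L : ℝ) + 1) with hM
  have hM0 : 0 ≤ M := by positivity
  have hM2 : 6 * ε * ((L : ℝ) + 1) ^ 2 < M ^ 2 := by
    rw [hM, mul_pow, mul_pow, Real.sq_sqrt hε.le]
    have : 0 < ε * ((L : ℝ) + 1) ^ 2 := by positivity
    linarith
  let e := stdOrthonormalBasis ℝ V
  let C : {x : V // ‖x‖ ≤ 1} → Set (V →L[ℝ] V) := fun x =>
    {H | ‖F x - H x‖ ≤ M ∧ ∀ i, ‖F (e i) - H (e i)‖ ≤ M}
  have hc1 : ∀ v : V, Convex ℝ {H : V →L[ℝ] V | ‖F v - H v‖ ≤ M} := by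
    intro v
    have : {H : V →L[ℝ] V | ‖F v - H v‖ ≤ M} =
        (ContinuousLinearMap.apply ℝ V v) ⁻¹' (Metric.closedBall (F v) M) := by
      ext H; simp [dist_eq_norm, norm_sub_rev]
    rw [this]
    exact (convex_closedBall _ _).linear_preimage (ContinuousLinearMap.apply ℝ V v).toLinearMap
  have hcl : ∀ v : V, IsClosed {H : V →L[ℝ] V | ‖F v - H v‖ ≤ M} := by
    intro v
    exact isClosed_le (by fun_prop) continuous_const
  have hCeq : ∀ x, C x = {H : V →L[ℝ] V | ‖F x - H x‖ ≤ M} ∩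
      ⋂ i, {H : V →L[ℝ] V | ‖F (e i) - H (e i)‖ ≤ M} := by
    intro x; ext H; simp [C]
  have hconv : ∀ x, Convex ℝ (C x) := by
    intro x
    rw [hCeq]
    exact (hc1 _).inter (convex_iInter fun i => hc1 _)
  have hcomp : ∀ x, IsCompact (C x) := by
    intro x
    have hclosed : IsClosed (C x) := by
      rw [hCeq]
      exact (hcl _).inter (isClosed_iInter fun i => hcl _)
    let T : (Fin (Module.finrank ℝ V) → V) →ₗ[ℝ] (V →L[ℝ] V) :=
      LinearMap.toContinuousLinearMap.toLinearMap ∘ₗ (e.toBasis.constr ℝ).toLinearMap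
    have hT : Continuous T := T.continuous_of_finiteDimensional
    have hK : IsCompact (T '' (Set.univ.pi fun i => Metric.closedBall (F (e i)) M)) :=
      (isCompact_univ_pi fun i => isCompact_closedBall _ _).image hT
    refine hK.of_isClosed_subset hclosed ?_
    rintro H ⟨-, hH⟩
    refine ⟨fun i => H (e i), ?_, ?_⟩
    · intro i _
      simpa [dist_eq_norm, norm_sub_rev] using hH i
    · apply ContinuousLinearMap.coe_injective
      apply e.toBasis.ext
      intro i
      have := e.toBasis.constr_basis ℝ (fun i => H (e i)) i
      simpa [T] using this
  have hfr : Module.finrank ℝ (V →L[ℝ] V) = Module.finrank ℝ V * Module.finrank ℝ V := by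
    rw [← (LinearMap.toContinuousLinearMap (𝕜 := ℝ) (E := V) (F' := V)).finrank_eq, Module.finrank_linearMap]
  have := Convex.helly_theorem_compact' (𝕜 := ℝ) hconv hcomp (by
    intro I hI
    classical
    let y : (I ⊕ Fin (Module.finrank ℝ V)) → V := Sum.elim (fun x => x.1.1) (fun i => e i)
    obtain ⟨H, hH⟩ := finite_approx hε.le h y (by
      rintro (i | i)
      · exact i.1.2
      · simp [y]) L (by
        rw [hfr] at hI
        simp only [Fintype.card_sum, Fintype.card_coe, Fintype.card_fin]
        omega) (M ^ 2) hM2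
    have hH' : ∀ i, ‖F (y i) - H (y i)‖ ≤ M := fun i =>
      (pow_le_pow_iff_left₀ (norm_nonneg _) hM0 two_ne_zero).1 (hH i).le
    refine ⟨LinearMap.toContinuousLinearMap H, ?_⟩
    simp only [Set.mem_iInter]
    intro x hx
    exact ⟨hH' (Sum.inl ⟨x, hx⟩), fun i => hH' (Sum.inr i)⟩)
  obtain ⟨H, hH⟩ := this
  rw [Set.mem_iInter] at hH
  exact ⟨H.toLinearMap, fun x hx => (hH ⟨x, hx⟩).1⟩

lemma homogenize (f : V → V) (ε : ℝ) (hε : 0 ≤ ε)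
    (hc : ContinuousOn f (Metric.closedBall 0 1))
    (hs : ∀ x y : V, ‖x‖ ≤ 1 → ‖y‖ ≤ 1 → |inner ℝ (f x) (f y) - inner ℝ x y| ≤ ε) :
    ∃ F : V → V, QL F ε ∧ ∀ x, ‖x‖ ≤ 1 → ‖f x - F x‖ ≤ 2 * √ε := by
  let g : V → V := fun u => (1/2 : ℝ) • (f u - f (-u))
  let F : V → V := fun x => ‖x‖ • g (‖x‖⁻¹ • x)
  have hu : ∀ x : V, ‖‖x‖⁻¹ • x‖ ≤ 1 := by
    intro x
    rw [norm_smul, norm_inv, norm_norm]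
    exact inv_mul_le_one
  have hxu : ∀ x : V, x = ‖x‖ • (‖x‖⁻¹ • x) := by
    intro x
    rcases eq_or_ne x 0 with rfl | hx
    · simp
    · rw [smul_smul, mul_inv_cancel₀ (norm_ne_zero_iff.2 hx), one_smul]
  have hg : ∀ u v : V, ‖u‖ ≤ 1 → ‖v‖ ≤ 1 → |inner ℝ (g u) (g v) - inner ℝ u v| ≤ ε := by
    intro u v hu hv
    have e1 := abs_le.1 (hs u v hu hv)
    have e2 := abs_le.1 (hs (-u) v (by simpa) hv)
    have e3 := abs_le.1 (hs u (-v) hu (by simpa))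
    have e4 := abs_le.1 (hs (-u) (-v) (by simpa) (by simpa))
    simp only [g, inner_smul_left, inner_smul_right, inner_sub_left, inner_sub_right,
      inner_neg_left, inner_neg_right] at *
    simp only [conj_trivial]
    rw [abs_le]
    constructor <;> linarith
  have happ : ∀ x y, |inner ℝ (F x) (F y) - inner ℝ x y| ≤ ε * (‖x‖ * ‖y‖) := by
    intro x y
    have h1 := hg _ _ (hu x) (hu y)
    have : inner ℝ (F x) (F y) - inner ℝ x y = (‖x‖ * ‖y‖) *
        (inner ℝ (g (‖x‖⁻¹ • x)) (g (‖y‖⁻¹ • y)) - inner ℝ (‖x‖⁻¹ • x) (‖y‖⁻¹ • y)) := by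
      conv_lhs => rw [hxu x, hxu y]
      rw [← hxu x, ← hxu y]
      conv_lhs => enter [2]; rw [hxu x, hxu y]
      simp only [F, inner_smul_left _ _ ‖x‖, inner_smul_right _ _ ‖y‖]
      simp only [conj_trivial]
      ring
    rw [this, abs_mul, abs_of_nonneg (by positivity : 0 ≤ ‖x‖ * ‖y‖), mul_comm ε]
    gcongr
  have hgodd : ∀ u, g (-u) = - g u := by
    intro u
    simp only [g, neg_neg]
    module
  have hhom : ∀ (c : ℝ) x, F (c • x) = c • F x := by
    intro c x
    rcases lt_trichotomy c 0 with hc | rfl | hc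
    · simp only [F, norm_smul, Real.norm_of_nonpos hc.le]
      have : (-c * ‖x‖)⁻¹ • c • x = -(‖x‖⁻¹ • x) := by
        rw [smul_smul, mul_inv, ← neg_smul]
        congr 1
        have := hc.ne
        field_simp
      rw [this, hgodd]
      module
    · simp [F]
    · simp only [F, norm_smul, Real.norm_of_nonneg hc.le]
      have : (c * ‖x‖)⁻¹ • c • x = (‖x‖⁻¹ • x) := by
        rw [smul_smul, mul_inv]
        congr 1
        have := hc.ne'
        field_simp
      rw [this]
      module
  have hcont : Continuous F := by
    rw [continuous_iff_continuousAt]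
    intro x
    rcases eq_or_ne x 0 with rfl | hx
    · have hF0 : F 0 = 0 := by simp [F]
      have hb : ∀ y, ‖F y‖ ≤ √(1 + ε) * ‖y‖ := by
        intro y
        have h1 := (abs_le.1 (happ y y)).2
        rw [real_inner_self_eq_norm_sq, real_inner_self_eq_norm_sq] at h1
        refine (pow_le_pow_iff_left₀ (norm_nonneg _) (by positivity) two_ne_zero).1 ?_
        rw [mul_pow, Real.sq_sqrt (by positivity)]
        nlinarith
      rw [ContinuousAt, hF0]
      refine squeeze_zero_norm hb ?_
      have : Continuous fun y : V => √(1 + ε) * ‖y‖ := by fun_prop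
      simpa using this.tendsto 0
    · have hgc : ContinuousOn g (Metric.closedBall 0 1) := by
        have : ContinuousOn (fun u => f (-u)) (Metric.closedBall 0 1) :=
          hc.comp continuous_neg.continuousOn (fun u hu => by simpa using hu)
        exact continuousOn_const.smul (hc.sub this)
      have h1 : ContinuousOn (fun x : V => ‖x‖⁻¹ • x) {0}ᶜ :=
        (continuous_norm.continuousOn.inv₀ (fun y hy => norm_ne_zero_iff.2 hy)).smul continuousOn_id
      have h2 : ContinuousOn F {0}ᶜ :=
        continuous_norm.continuousOn.smul (hgc.comp h1 (fun y _ => by simpa using hu y))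
      exact h2.continuousAt (isOpen_compl_singleton.mem_nhds hx)
  refine ⟨F, ⟨hcont, hhom, happ⟩, fun x hx => ?_⟩
  set u := ‖x‖⁻¹ • x with hudef
  have hu1 : ‖u‖ ≤ 1 := hu x
  have hFx : F x = (‖x‖ / 2) • f u - (‖x‖ / 2) • f (-u) := by
    simp only [F, g, ← hudef]
    module
  set r := ‖x‖ with hr
  have hxr : x = r • u := hxu x
  have hr0 : 0 ≤ r := norm_nonneg x
  have key : ‖f x - F x‖ ^ 2 ≤ ε * (1 + r) ^ 2 := by
    rw [hFx, ← real_inner_self_eq_norm_sq]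
    have e1 := abs_le.1 (hs x x hx hx)
    have e2 := abs_le.1 (hs x u hx hu1)
    have e3 := abs_le.1 (hs x (-u) hx (by simpa))
    have e4 := abs_le.1 (hs u u hu1 hu1)
    have e5 := abs_le.1 (hs u (-u) hu1 (by simpa))
    have e6 := abs_le.1 (hs (-u) (-u) (by simpa) (by simpa))
    have i1 : inner ℝ x x = r * r * inner ℝ u u := by
      rw [hxr]; simp only [inner_smul_left, inner_smul_right, conj_trivial]; ring
    have i2 : inner ℝ x u = r * inner ℝ u u := by
      rw [hxr]; simp only [inner_smul_left, inner_smul_right, conj_trivial]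
    simp only [inner_neg_left, inner_neg_right, i1, i2] at e1 e2 e3 e4 e5 e6
    simp only [inner_sub_left, inner_sub_right, inner_smul_left, inner_smul_right, conj_trivial]
    rw [real_inner_comm (f x) (f u), real_inner_comm (f x) (f (-u)), real_inner_comm (f u) (f (-u))]
    nlinarith [mul_nonneg hr0 hr0]
  refine (pow_le_pow_iff_left₀ (norm_nonneg _) (by positivity) two_ne_zero).1 ?_
  rw [mul_pow, Real.sq_sqrt hε]
  refine key.trans ?_
  rw [mul_comm ε]
  gcongr
  linarith

lemma general [FiniteDimensional ℝ V] (f : V → V) (ε : ℝ) (hε : 0 < ε)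
    (hc : ContinuousOn f (Metric.closedBall 0 1))
    (hs : ∀ x y : V, ‖x‖ ≤ 1 → ‖y‖ ≤ 1 → |inner ℝ (f x) (f y) - inner ℝ x y| ≤ ε)
    (L : ℕ) (hL : Module.finrank ℝ V * Module.finrank ℝ V + 1 + Module.finrank ℝ V ≤ 2 ^ L) :
    ∃ H : V →ₗ[ℝ] V, ∀ x, ‖x‖ ≤ 1 → ‖f x - H x‖ ≤ √ε * (3 * (L : ℝ) + 5) := by
  obtain ⟨F, hF, hfF⟩ := homogenize f ε hε.le hc hs
  obtain ⟨H, hH⟩ := global_approx hε hF L hL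
  refine ⟨H, fun x hx => ?_⟩
  have h1 := hfF x hx
  have h2 := hH x hx
  have h3 := norm_add_le (f x - F x) (F x - H x)
  rw [sub_add_sub_cancel] at h3
  nlinarith

end QLAux

namespace QLAux

def HV (d : ℕ) : Type := HermMat d

noncomputable instance (d : ℕ) : AddCommGroup (HV d) := inferInstanceAs (AddCommGroup (HermMat d))
noncomputable instance (d : ℕ) : Module ℝ (HV d) := inferInstanceAs (Module ℝ (HermMat d))

lemma hsInner_eq {d : ℕ} (x y : HermMat d) :
    hsInner x y = ∑ i, ∑ j, (((x : Matrix (Fin d) (Fin d) ℂ) i j).re * ((y : Matrix (Fin d) (Fin d) ℂ) i j).re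
      + ((x : Matrix (Fin d) (Fin d) ℂ) i j).im * ((y : Matrix (Fin d) (Fin d) ℂ) i j).im) := by
  unfold hsInner
  simp only [Matrix.trace, Matrix.diag, Matrix.mul_apply, Complex.re_sum]
  refine Finset.sum_congr rfl fun i _ => Finset.sum_congr rfl fun j _ => ?_
  have hy : star (y : Matrix (Fin d) (Fin d) ℂ) = y := y.2
  have h1 : (y : Matrix (Fin d) (Fin d) ℂ) j i = star ((y : Matrix (Fin d) (Fin d) ℂ) i j) := by
    conv_lhs => rw [← hy]
    rfl
  rw [h1]
  simp

lemma hs_symm {d : ℕ} (x y : HermMat d) : hsInner y x = hsInner x y := by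
  rw [hsInner_eq, hsInner_eq]
  refine Finset.sum_congr rfl fun i _ => Finset.sum_congr rfl fun j _ => ?_
  ring

lemma hs_nonneg {d : ℕ} (x : HermMat d) : 0 ≤ hsInner x x := by
  rw [hsInner_eq]
  exact Finset.sum_nonneg fun i _ => Finset.sum_nonneg fun j _ =>
    add_nonneg (mul_self_nonneg _) (mul_self_nonneg _)

lemma hs_add {d : ℕ} (x y z : HermMat d) :
    hsInner (x + y) z = hsInner x z + hsInner y z := by
  simp [hsInner, add_mul]

lemma hs_smul {d : ℕ} (x y : HermMat d) (r : ℝ) : hsInner (r • x) y = r * hsInner x y := by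
  simp [hsInner]

lemma hs_def {d : ℕ} (x : HermMat d) (hx : hsInner x x = 0) : x = 0 := by
  rw [hsInner_eq] at hx
  have hn : ∀ i j, 0 ≤ ((x : Matrix (Fin d) (Fin d) ℂ) i j).re * ((x : Matrix (Fin d) (Fin d) ℂ) i j).re
    + ((x : Matrix (Fin d) (Fin d) ℂ) i j).im * ((x : Matrix (Fin d) (Fin d) ℂ) i j).im :=
    fun i j => add_nonneg (mul_self_nonneg _) (mul_self_nonneg _)
  apply Subtype.ext
  ext i j
  have h1 := (Finset.sum_eq_zero_iff_of_nonneg (fun i _ => Finset.sum_nonneg fun j _ => hn i j)).1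
    hx i (Finset.mem_univ i)
  have h2 := (Finset.sum_eq_zero_iff_of_nonneg (fun j _ => hn i j)).1 h1 j (Finset.mem_univ j)
  have h3 : Complex.normSq ((x : Matrix (Fin d) (Fin d) ℂ) i j) = 0 := h2
  exact Complex.normSq_eq_zero.1 h3

@[reducible] noncomputable def core (d : ℕ) : InnerProductSpace.Core ℝ (HV d) where
  inner x y := hsInner (d := d) x y
  conj_inner_symm x y := hs_symm (d := d) x y
  re_inner_nonneg x := hs_nonneg (d := d) x
  add_left x y z := hs_add (d := d) x y z
  smul_left x y r := hs_smul (d := d) x y r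
  definite x hx := hs_def (d := d) x hx

noncomputable instance instNACG (d : ℕ) : NormedAddCommGroup (HV d) := (core d).toNormedAddCommGroup
noncomputable instance instIPS (d : ℕ) : InnerProductSpace ℝ (HV d) := InnerProductSpace.ofCore (core d).toCore

lemma inner_HV {d : ℕ} (x y : HV d) : inner ℝ x y = hsInner (d := d) x y := rfl

lemma norm_HV {d : ℕ} (x : HV d) : ‖x‖ = hsNorm (d := d) x := by
  exact norm_eq_sqrt_real_inner x

instance (d : ℕ) : ContinuousSMul ℝ (HermMat d) :=
  ⟨by
    rw [continuous_induced_rng]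
    exact (continuous_fst.smul (continuous_subtype_val.comp continuous_snd) :
      Continuous fun p : ℝ × HermMat d => p.1 • (p.2 : Matrix (Fin d) (Fin d) ℂ))⟩

noncomputable def incl (d : ℕ) : HermMat d →ₗ[ℝ] Matrix (Fin d) (Fin d) ℂ where
  toFun x := x
  map_add' _ _ := rfl
  map_smul' _ _ := rfl

lemma incl_inj (d : ℕ) : Function.Injective (incl d) := Subtype.val_injective

instance (d : ℕ) : FiniteDimensional ℝ (HermMat d) :=
  FiniteDimensional.of_injective (incl d) (incl_inj d)

instance (d : ℕ) : FiniteDimensional ℝ (HV d) := inferInstanceAs (FiniteDimensional ℝ (HermMat d))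

lemma finrank_HV (d : ℕ) : Module.finrank ℝ (HV d) ≤ 2 * d ^ 2 := by
  have h := LinearMap.finrank_le_finrank_of_injective (incl_inj d)
  have h2 : Module.finrank ℝ (Matrix (Fin d) (Fin d) ℂ) = 2 * d ^ 2 := by
    rw [Module.finrank_matrix]
    simp [Complex.finrank_real_complex]; ring
  rw [h2] at h
  exact h

noncomputable def toHV (d : ℕ) : HermMat d ≃ₗ[ℝ] HV d := LinearEquiv.refl ℝ (HermMat d)

end QLAux

theorem stmt10 (d : ℕ) (hd : 1 ≤ d) (ε : ℝ) (hε : 0 < ε)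
    (f : HermMat d → HermMat d)
    (hcont : ContinuousOn f { x : HermMat d | hsNorm x ≤ 1 })
    (hsym : ∀ x ∈ { x : HermMat d | hsNorm x ≤ 1 }, ∀ y ∈ { x : HermMat d | hsNorm x ≤ 1 },
      |hsInner (f x) (f y) - hsInner x y| ≤ ε) :
    ∃ H : HermMat d →ₗ[ℝ] HermMat d, ∀ x ∈ { x : HermMat d | hsNorm x ≤ 1 },
      hsNorm (f x - H x) ≤ 79 * Real.sqrt ε * (1 + Real.logb 2 d) := by
  obtain ⟨H, hH⟩ := QLAux.general (V := QLAux.HV d) (fun x => QLAux.toHV d (f ((QLAux.toHV d).symm x))) ε hε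
    (by
      have c1 : Continuous (QLAux.toHV d) := (QLAux.toHV d).toLinearMap.continuous_of_finiteDimensional
      have c2 : Continuous (QLAux.toHV d).symm := (QLAux.toHV d).symm.toLinearMap.continuous_of_finiteDimensional
      refine c1.comp_continuousOn (hcont.comp c2.continuousOn ?_)
      intro x hx
      rw [mem_closedBall_zero_iff, QLAux.norm_HV] at hx
      exact hx)
    (by
      intro x y hx hy
      rw [QLAux.norm_HV] at hx hy
      exact hsym x hx y hy)
    (Nat.log 2 (d ^ 4) + 4)
    (by
      have h1 := QLAux.finrank_HV d
      have h2 : d ^ 4 < 2 ^ (Nat.log 2 (d ^ 4) + 1) := Nat.lt_pow_succ_log_self (by norm_num) _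
      have h3 : Module.finrank ℝ (QLAux.HV d) * Module.finrank ℝ (QLAux.HV d) ≤ (2 * d ^ 2) * (2 * d ^ 2) :=
        Nat.mul_le_mul h1 h1
      have h4 : d ^ 2 ≤ d ^ 4 := Nat.pow_le_pow_right hd (by norm_num)
      have h5 : 1 ≤ d ^ 4 := Nat.one_le_pow _ _ hd
      have h6 : (2 * d ^ 2) * (2 * d ^ 2) = 4 * d ^ 4 := by ring
      have h7 : 2 ^ (Nat.log 2 (d ^ 4) + 4) = 8 * 2 ^ (Nat.log 2 (d ^ 4) + 1) := by ring
      omega)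
  refine ⟨(QLAux.toHV d).symm.toLinearMap ∘ₗ H ∘ₗ (QLAux.toHV d).toLinearMap, fun x hx => ?_⟩
  have h := hH (QLAux.toHV d x) (by rw [QLAux.norm_HV]; exact hx)
  rw [QLAux.norm_HV] at h
  have hlog : ((Nat.log 2 (d ^ 4) : ℕ) : ℝ) ≤ 4 * Real.logb 2 d := by
    have h1 := Real.natLog_le_logb (d ^ 4) 2
    have h2 : Real.logb ((2 : ℕ) : ℝ) ((d ^ 4 : ℕ) : ℝ) = 4 * Real.logb 2 d := by
      push_cast
      rw [Real.logb_pow]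
      norm_num
    rw [h2] at h1
    exact h1
  have hl0 : 0 ≤ Real.logb 2 d := Real.logb_nonneg (by norm_num) (by exact_mod_cast hd)
  refine le_trans h ?_
  rw [mul_comm (79 : ℝ), mul_assoc]
  gcongr
  push_cast
  linarith
end
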